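/- Let V : ℝ^d → ℝ be differentiable with L-Lipschitz gradient, let σ > 0 and x ∈ ℝ^d, and let u be a standard Gaussian random vector on ℝ^d (u ~ N(0, I_d)). Then the Gaussian-smoothing gradient estimate satisfies the bias bound | E_u[ ((V(x+σu) − V(x))/σ) · u ] − ∇V(x) |² ≤ L² σ² d. -/

import Mathlib

open MeasureTheory Real

/-- The standard Gaussian measure `N(0, I_d)` on `ℝ^d`, given by its density
`(2π)^{-d/2} exp(-|u|²/2)` with respect to Lebesgue measure. -/
noncomputable def stdGaussian (d : ℕ) : Measure (EuclideanSpace ℝ (Fin d)) :=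
  volume.withDensity fun u =>
    ENNReal.ofReal ((2 * Real.pi) ^ (-(d : ℝ) / 2) * Real.exp (-‖u‖ ^ 2 / 2))

/-- The Gaussian density. -/
noncomputable def gDens (d : ℕ) (u : EuclideanSpace ℝ (Fin d)) : ℝ :=
  (2 * Real.pi) ^ (-(d : ℝ) / 2) * Real.exp (-‖u‖ ^ 2 / 2)

lemma gDens_nonneg (d : ℕ) (u : EuclideanSpace ℝ (Fin d)) : 0 ≤ gDens d u := by
  unfold gDens; positivity

lemma gDens_continuous (d : ℕ) : Continuous (gDens d) := by
  unfold gDens; fun_prop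

lemma integral_stdGaussian {d : ℕ} {G : Type*} [NormedAddCommGroup G] [NormedSpace ℝ G]
    (F : EuclideanSpace ℝ (Fin d) → G) :
    ∫ u, F u ∂(stdGaussian d) = ∫ u, gDens d u • F u := by
  have : stdGaussian d = volume.withDensity fun u => ENNReal.ofReal (gDens d u) := rfl
  rw [this, integral_withDensity_eq_integral_toReal_smul]
  · simp only [ENNReal.toReal_ofReal (gDens_nonneg d _)]
  · exact (gDens_continuous d).measurable.ennreal_ofReal
  · simp

lemma gDens_integral (d : ℕ) : ∫ u, gDens d u = 1 := by
  unfold gDens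
  rw [integral_const_mul]
  have := GaussianFourier.integral_rexp_neg_mul_sq_norm (V := EuclideanSpace ℝ (Fin d))
    (b := 1 / 2) (by norm_num)
  have h2 : ∀ u : EuclideanSpace ℝ (Fin d), rexp (-‖u‖ ^ 2 / 2) = rexp (-(1/2) * ‖u‖ ^ 2) := by
    intro u; congr 1; ring
  simp only [h2]
  rw [this, finrank_euclideanSpace_fin, show π / (1 / 2) = 2 * π by ring,
    ← Real.rpow_add (by positivity)]
  rw [show -(d : ℝ) / 2 + d / 2 = 0 by ring, Real.rpow_zero]

lemma integrable_rexp_sq {d : ℕ} :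
    Integrable (fun u : EuclideanSpace ℝ (Fin d) => rexp (-(1/4) * ‖u‖ ^ 2)) := by
  by_contra h
  have h1 := GaussianFourier.integral_rexp_neg_mul_sq_norm (V := EuclideanSpace ℝ (Fin d))
    (b := 1 / 4) (by norm_num)
  rw [integral_undef h] at h1
  have : 0 < (π / (1/4)) ^ ((Module.finrank ℝ (EuclideanSpace ℝ (Fin d)) : ℝ) / 2) := by positivity
  linarith

lemma integrable_poly {d : ℕ} {G : Type*} [NormedAddCommGroup G] [NormedSpace ℝ G]
    {F : EuclideanSpace ℝ (Fin d) → G} (hF : AEStronglyMeasurable F volume) (K : ℝ)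
    (hK : ∀ u, ‖F u‖ ≤ K * (1 + ‖u‖) ^ 3) :
    Integrable (fun u => gDens d u • F u) := by
  have hK0 : 0 ≤ K := by
    have := (norm_nonneg _).trans (hK 0)
    simpa using this
  refine Integrable.mono' (integrable_rexp_sq.const_mul
    ((2 * Real.pi) ^ (-(d : ℝ) / 2) * (K * (6 * rexp 2))))
    ((gDens_continuous d).aestronglyMeasurable.smul hF) (Filter.Eventually.of_forall fun u => ?_)
  rw [norm_smul, Real.norm_of_nonneg (gDens_nonneg d u), gDens]
  have h1 : (1 + ‖u‖) ^ 3 ≤ 6 * rexp (1 + ‖u‖) := by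
    have := Real.pow_div_factorial_le_exp (x := 1 + ‖u‖) (by positivity) 3
    norm_num [Nat.factorial] at this
    linarith
  have h2 : rexp (-‖u‖ ^ 2 / 2) * rexp (1 + ‖u‖) ≤ rexp 2 * rexp (-(1/4) * ‖u‖ ^ 2) := by
    rw [← Real.exp_add, ← Real.exp_add, Real.exp_le_exp]
    nlinarith [sq_nonneg (‖u‖ - 2)]
  have hc : 0 ≤ (2 * Real.pi) ^ (-(d : ℝ) / 2) := by positivity
  calc _ ≤ (2 * Real.pi) ^ (-(d : ℝ) / 2) * rexp (-‖u‖ ^ 2 / 2) * (K * (6 * rexp (1 + ‖u‖))) := by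
        gcongr; exact (hK u).trans (by gcongr)
    _ = (2 * Real.pi) ^ (-(d : ℝ) / 2) * (K * 6) * (rexp (-‖u‖ ^ 2 / 2) * rexp (1 + ‖u‖)) := by ring
    _ ≤ (2 * Real.pi) ^ (-(d : ℝ) / 2) * (K * 6) * (rexp 2 * rexp (-(1/4) * ‖u‖ ^ 2)) := by gcongr
    _ = _ := by ring

lemma gDens_hasFDerivAt (d : ℕ) (u : EuclideanSpace ℝ (Fin d)) :
    HasFDerivAt (gDens d) (-(gDens d u) • innerSL ℝ u) u := by
  have h := ((hasStrictFDerivAt_norm_sq u).hasFDerivAt.const_mul (-1/2 : ℝ)).exp.const_mul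
    ((2 * Real.pi) ^ (-(d : ℝ) / 2))
  have e : gDens d = fun u => (2 * Real.pi) ^ (-(d : ℝ) / 2) * rexp (-1 / 2 * ‖u‖ ^ 2) := by
    funext v; unfold gDens; congr 2; ring
  rw [e]
  refine h.congr_fderiv ?_
  ext v
  simp
  ring

/-- Stein's lemma. -/
lemma stein {d : ℕ} {f : EuclideanSpace ℝ (Fin d) → ℝ} (hf : Differentiable ℝ f) (K : ℝ)
    (h0 : ∀ u, ‖f u‖ ≤ K * (1 + ‖u‖) ^ 2) (h1 : ∀ u, ‖fderiv ℝ f u‖ ≤ K * (1 + ‖u‖) ^ 2)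
    (e : EuclideanSpace ℝ (Fin d)) :
    ∫ u, gDens d u * (f u * inner ℝ u e) = ∫ u, gDens d u * fderiv ℝ f u e := by
  have hK0 : 0 ≤ K := by
    have := (norm_nonneg _).trans (h0 0)
    simpa using this
  have hfd : ∀ u, fderiv ℝ (gDens d) u e = -(gDens d u) * inner ℝ u e := by
    intro u; rw [(gDens_hasFDerivAt d u).fderiv]; simp
  have h23 : ∀ u : EuclideanSpace ℝ (Fin d), (1 + ‖u‖) ^ 2 ≤ (1 + ‖u‖) ^ 3 := fun u =>
    pow_le_pow_right₀ (by linarith [norm_nonneg u]) (by norm_num)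
  have i1 : Integrable (fun u => gDens d u • f u) :=
    integrable_poly hf.continuous.aestronglyMeasurable K
      (fun u => (h0 u).trans (mul_le_mul_of_nonneg_left (h23 u) hK0))
  have i2 : Integrable (fun u => gDens d u • fderiv ℝ f u e) := by
    refine integrable_poly (measurable_fderiv_apply_const ℝ f e).aestronglyMeasurable (K * ‖e‖)
      (fun u => ((fderiv ℝ f u).le_opNorm e).trans ?_)
    calc _ ≤ K * (1 + ‖u‖) ^ 3 * ‖e‖ := by gcongr; exact (h1 u).trans (mul_le_mul_of_nonneg_left (h23 u) hK0)
      _ = _ := by ring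
  have i3 : Integrable (fun u => gDens d u • (f u * inner ℝ u e)) := by
    have := hf.continuous
    refine integrable_poly (Continuous.aestronglyMeasurable (by fun_prop)) (K * ‖e‖) (fun u => ?_)
    rw [norm_mul]
    calc _ ≤ (K * (1 + ‖u‖) ^ 2) * (‖u‖ * ‖e‖) := by
          gcongr
          · exact h0 u
          · exact norm_inner_le_norm u e
      _ ≤ (K * (1 + ‖u‖) ^ 2) * ((1 + ‖u‖) * ‖e‖) := by gcongr; linarith
      _ = _ := by ring
  simp only [smul_eq_mul] at i1 i2 i3
  have := integral_mul_fderiv_eq_neg_fderiv_mul_of_integrable (μ := volume) (f := f) (g := gDens d)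
    (v := e) (by simpa only [mul_comm] using i2)
    (by
      simp only [hfd]
      refine i3.neg.congr (Filter.Eventually.of_forall fun u => ?_)
      simp only [Pi.neg_apply]; ring)
    (by simpa only [mul_comm] using i1) (fun u _ => hf u)
    (fun u _ => (gDens_hasFDerivAt d u).differentiableAt)
  simp only [hfd] at this
  have e1 : ∀ u, f u * (-gDens d u * inner ℝ u e) = -(gDens d u * (f u * inner ℝ u e)) := by
    intro u; ring
  simp only [e1, integral_neg, neg_inj] at this
  rw [this]
  simp only [mul_comm]

lemma gDens_sq (d : ℕ) : ∫ u, gDens d u * ‖u‖ ^ 2 = d := by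
  have hc : ∀ i : Fin d, ∫ u, gDens d u * (u i) ^ 2 = 1 := by
    intro i
    have hs := stein (d := d) (f := fun u => inner ℝ (EuclideanSpace.single i (1:ℝ)) u)
      (innerSL ℝ (EuclideanSpace.single i (1:ℝ))).differentiable 1 (fun u => by
        refine (norm_inner_le_norm _ _).trans ?_
        simp; nlinarith [norm_nonneg u]) (fun u => by
        have : HasFDerivAt (fun u => inner ℝ (EuclideanSpace.single i (1:ℝ)) u)
          (innerSL ℝ (EuclideanSpace.single i (1:ℝ))) u := (innerSL ℝ _).hasFDerivAt
        rw [this.fderiv, innerSL_apply_norm, EuclideanSpace.norm_single, norm_one]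
        nlinarith [norm_nonneg u]) (EuclideanSpace.single i (1:ℝ))
    have hd : ∀ u, fderiv ℝ (fun u => inner ℝ (EuclideanSpace.single i (1:ℝ)) u) u
        (EuclideanSpace.single i (1:ℝ)) = 1 := by
      intro u
      have : HasFDerivAt (fun u => inner ℝ (EuclideanSpace.single i (1:ℝ)) u)
          (innerSL ℝ (EuclideanSpace.single i (1:ℝ))) u := (innerSL ℝ _).hasFDerivAt
      rw [this.fderiv]; simp
    simp only [hd, mul_one, gDens_integral] at hs
    rw [← hs]
    congr 1; ext u
    simp [EuclideanSpace.inner_single_left, EuclideanSpace.inner_single_right]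
    left; ring
  simp only [EuclideanSpace.real_norm_sq_eq, Finset.mul_sum]
  rw [integral_finsetSum]
  · simp [hc]
  · intro i _
    by_contra h
    have := hc i
    rw [integral_undef h] at this
    norm_num at this

/-- Bias bound for the Gaussian-smoothing gradient estimator: if `V` has
`L`-Lipschitz gradient, then
`|E_u[((V(x+σu) − V(x))/σ) u] − ∇V(x)|² ≤ L² σ² d`. -/
theorem gaussian_smoothing_bias_bound
    (d : ℕ) (V : EuclideanSpace ℝ (Fin d) → ℝ)
    (hV : Differentiable ℝ V)
    (L : ℝ) (hL : 0 < L)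
    (hlip : ∀ x y, ‖gradient V x - gradient V y‖ ≤ L * ‖x - y‖)
    (σ : ℝ) (hσ : 0 < σ) (x : EuclideanSpace ℝ (Fin d)) :
    ‖(∫ u, ((V (x + σ • u) - V x) / σ) • u ∂(stdGaussian d)) - gradient V x‖ ^ 2
      ≤ L ^ 2 * σ ^ 2 * d := by
  rw [integral_stdGaussian]
  set w := (∫ u, gDens d u • ((V (x + σ • u) - V x) / σ) • u) - gradient V x with hw
  have hin : ∀ y v, fderiv ℝ V y v = inner ℝ (gradient V y) v := by
    intro y v
    simp [gradient]
  have hgn : ∀ y, ‖fderiv ℝ V y‖ = ‖gradient V y‖ := by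
    intro y; simp [gradient]
  set f : EuclideanSpace ℝ (Fin d) → ℝ := fun u => (V (x + σ • u) - V x) / σ with hfdef
  have hfd : ∀ u, HasFDerivAt f (fderiv ℝ V (x + σ • u)) u := by
    intro u
    have h1 : HasFDerivAt (fun u : EuclideanSpace ℝ (Fin d) => x + σ • u)
        (σ • ContinuousLinearMap.id ℝ (EuclideanSpace ℝ (Fin d))) u :=
      ((hasFDerivAt_id u).const_smul σ).const_add x
    have h2 := (((hV (x + σ • u)).hasFDerivAt.comp u h1).sub_const (V x)).mul_const σ⁻¹
    simp only [hfdef, div_eq_mul_inv]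
    refine h2.congr_fderiv ?_
    ext v
    simp
    field_simp
  have hf : Differentiable ℝ f := fun u => (hfd u).differentiableAt
  set G := ‖gradient V x‖ with hG
  have hG0 : 0 ≤ G := norm_nonneg _
  have hgb : ∀ y, ‖fderiv ℝ V y‖ ≤ G + L * ‖y - x‖ := by
    intro y
    rw [hgn]
    have := norm_le_norm_add_norm_sub (gradient V x) (gradient V y)
    have h2 := hlip y x
    rw [norm_sub_rev] at h2
    linarith
  have hb1 : ∀ u, ‖fderiv ℝ f u‖ ≤ (G + L * σ) * (1 + ‖u‖) ^ 2 := by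
    intro u
    rw [(hfd u).fderiv]
    refine (hgb _).trans ?_
    have : ‖x + σ • u - x‖ = σ * ‖u‖ := by
      rw [add_sub_cancel_left, norm_smul, Real.norm_of_nonneg hσ.le]
    rw [this]
    have hLs : 0 < L * σ := by positivity
    have hu := norm_nonneg u
    nlinarith [mul_nonneg hG0 hu, mul_nonneg hLs.le hu, mul_nonneg hG0 (sq_nonneg ‖u‖),
      mul_nonneg hLs.le (sq_nonneg ‖u‖)]
  have hb0 : ∀ u, ‖f u‖ ≤ (G + L * σ) * (1 + ‖u‖) ^ 2 := by
    intro u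
    have hu := norm_nonneg u
    have hLs : 0 < L * σ := by positivity
    have h := (convex_closedBall (0 : EuclideanSpace ℝ (Fin d)) ‖u‖).norm_image_sub_le_of_norm_hasFDerivWithin_le
      (f := f) (f' := fun u => fderiv ℝ V (x + σ • u)) (C := G + L * (σ * ‖u‖)) (x := 0) (y := u)
      (fun v _ => (hfd v).hasFDerivWithinAt) (fun v hv => by
        refine (hgb _).trans ?_
        rw [add_sub_cancel_left, norm_smul, Real.norm_of_nonneg hσ.le]
        have : ‖v‖ ≤ ‖u‖ := by simpa using hv
        gcongr) (by simp) (by simp)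
    have hf0 : f 0 = 0 := by simp [hfdef]
    rw [hf0, sub_zero, sub_zero] at h
    refine h.trans ?_
    nlinarith [mul_nonneg hG0 hu, mul_nonneg hLs.le hu, mul_nonneg hG0 (sq_nonneg ‖u‖),
      mul_nonneg hLs.le (sq_nonneg ‖u‖)]
  have hK0 : 0 ≤ G + L * σ := by positivity
  have iF : Integrable (fun u => gDens d u • f u • u) := by
    have := hf.continuous
    refine integrable_poly (Continuous.aestronglyMeasurable (by fun_prop)) (G + L * σ) (fun u => ?_)
    rw [norm_smul]
    calc _ ≤ ((G + L * σ) * (1 + ‖u‖) ^ 2) * (1 + ‖u‖) := by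
          gcongr
          · exact hb0 u
          · linarith
      _ = _ := by ring
  have i1 : Integrable (gDens d) := by
    have := integrable_poly (d := d) (F := fun _ => (1:ℝ)) aestronglyMeasurable_const 1 (fun u => by
      simp; exact one_le_pow₀ (by linarith [norm_nonneg u]))
    simpa using this
  have i2 : Integrable (fun u => gDens d u * ‖u‖ ^ 2) :=
    integrable_poly (F := fun u => ‖u‖ ^ 2) (Continuous.aestronglyMeasurable (by fun_prop)) 1 (fun u => by
      have hu := norm_nonneg u
      simp; nlinarith [pow_nonneg hu 3, pow_nonneg hu 2])
  have i3 : Integrable (fun u => gDens d u * fderiv ℝ f u w) := by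
    refine integrable_poly (measurable_fderiv_apply_const ℝ f w).aestronglyMeasurable
      ((G + L * σ) * ‖w‖) (fun u => ((fderiv ℝ f u).le_opNorm w).trans ?_)
    have h23 : (1 + ‖u‖) ^ 2 ≤ (1 + ‖u‖) ^ 3 :=
      pow_le_pow_right₀ (by linarith [norm_nonneg u]) (by norm_num)
    calc _ ≤ (G + L * σ) * (1 + ‖u‖) ^ 3 * ‖w‖ := by gcongr; exact (hb1 u).trans (by gcongr)
      _ = _ := by ring
  have key : ‖w‖ ^ 2 = (∫ u, gDens d u * fderiv ℝ f u w) - inner ℝ (gradient V x) w := by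
    rw [← stein hf _ hb0 hb1 w, ← real_inner_self_eq_norm_sq]
    conv_lhs => rw [hw]
    rw [inner_sub_left, ← hw, real_inner_comm, ← integral_inner iF]
    congr 2
    ext u
    simp only [inner_smul_right, real_inner_comm]
  have hmono : ∫ u, gDens d u * fderiv ℝ f u w ≤
      ∫ u, (gDens d u * (inner ℝ (gradient V x) w + ‖w‖ ^ 2 / 2)
        + (L ^ 2 * σ ^ 2 / 2) * (gDens d u * ‖u‖ ^ 2)) := by
    refine integral_mono i3 ((i1.mul_const _).add (i2.const_mul _)) (fun u => ?_)
    have h1 : fderiv ℝ f u w - inner ℝ (gradient V x) w ≤ (L * (σ * ‖u‖)) * ‖w‖ := by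
      rw [(hfd u).fderiv, hin, ← inner_sub_left]
      refine (real_inner_le_norm _ _).trans ?_
      have := hlip (x + σ • u) x
      rw [add_sub_cancel_left, norm_smul, Real.norm_of_nonneg hσ.le] at this
      gcongr
    have h2 : fderiv ℝ f u w ≤ inner ℝ (gradient V x) w + ‖w‖ ^ 2 / 2
        + L ^ 2 * σ ^ 2 / 2 * ‖u‖ ^ 2 := by
      nlinarith [sq_nonneg (L * (σ * ‖u‖) - ‖w‖)]
    calc _ ≤ gDens d u * _ := mul_le_mul_of_nonneg_left h2 (gDens_nonneg d u)
      _ = _ := by ring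
  rw [integral_add (i1.mul_const _) (i2.const_mul _), integral_mul_const, integral_const_mul,
    gDens_integral, gDens_sq] at hmono
  linarith
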